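/- arXiv:2203.09826 — 2 statements merged into one kernel-verified Lean document; each statement's English description precedes it below -/
import Mathlib

section
/- For every complex q with |q| < 1: ∑_{n≥0} q^n/(1 − q^{5n+1}) − ∑_{n≥0} q^{4n+3}/(1 − q^{5n+4}) = (q^2, q^3, q^5, q^5; q^5)_∞ / (q, q, q^4, q^4; q^5)_∞. -/
/-!
Common definitions: for a partition `π` of `n`,
`numParts` is the number of parts, `largestPart` the largest part,
`omegaOnes` the number of parts equal to 1, `rank` and `crank` the
Dyson rank and Andrews–Garvan crank.  `NT m j n` is the total number of
parts over partitions of `n` with rank ≡ m (mod j), and `Mw m j n` is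
the total number of ones over partitions of `n` with crank ≡ m (mod j).
`poch a q = (a; q)_∞ = ∏_{n ≥ 0} (1 - a qⁿ)`.
-/

namespace Beck

/-- number of parts of a partition -/
def numParts {n : ℕ} (π : n.Partition) : ℕ := Multiset.card π.parts

/-- largest part of a partition (0 for the empty partition) -/
def largestPart {n : ℕ} (π : n.Partition) : ℕ := π.parts.sup

/-- number of ones in a partition -/
def omegaOnes {n : ℕ} (π : n.Partition) : ℕ := π.parts.count 1

/-- number of parts strictly larger than the number of ones -/
def muParts {n : ℕ} (π : n.Partition) : ℕ :=
  Multiset.card (π.parts.filter fun x => omegaOnes π < x)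

/-- Dyson's rank: largest part minus number of parts -/
def rank {n : ℕ} (π : n.Partition) : ℤ :=
  (largestPart π : ℤ) - (numParts π : ℤ)

/-- the Andrews–Garvan crank -/
def crank {n : ℕ} (π : n.Partition) : ℤ :=
  if omegaOnes π = 0 then (largestPart π : ℤ)
  else (muParts π : ℤ) - (omegaOnes π : ℤ)

/-- `NT m j n`: total number of parts in partitions of `n` with rank ≡ m (mod j) -/
def NT (m j n : ℕ) : ℤ :=
  ∑ π : n.Partition,
    if rank π % (j : ℤ) = (m : ℤ) % (j : ℤ) then (numParts π : ℤ) else 0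

/-- `Mw m j n`: total number of ones in partitions of `n` with crank ≡ m (mod j) -/
def Mw (m j n : ℕ) : ℤ :=
  ∑ π : n.Partition,
    if crank π % (j : ℤ) = (m : ℤ) % (j : ℤ) then (omegaOnes π : ℤ) else 0

/-- `(a; q)_∞ = ∏_{n ≥ 0} (1 - a qⁿ)` -/
noncomputable def poch (a q : ℂ) : ℂ := ∏' n : ℕ, (1 - a * q ^ n)

open Filter Topology Finset

/-- `(a; q)_n = ∏_{i < n} (1 - a qⁱ)` -/
noncomputable def finPoch (a q : ℂ) (n : ℕ) : ℂ := ∏ i ∈ range n, (1 - a * q ^ i)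

lemma one_sub_mul_pow_ne_zero {a q : ℂ} (ha : ‖a‖ < 1) (hq : ‖q‖ < 1) (n : ℕ) :
    1 - a * q ^ n ≠ 0 := by
  intro h
  have h1 : ‖a * q ^ n‖ = 1 := by rw [← sub_eq_zero.mp h, norm_one]
  rw [norm_mul, norm_pow] at h1
  have h2 : ‖q‖ ^ n ≤ 1 := pow_le_one₀ (norm_nonneg _) hq.le
  nlinarith [norm_nonneg a]

lemma finPoch_ne_zero {a q : ℂ} (h : ∀ n : ℕ, 1 - a * q ^ n ≠ 0) (n : ℕ) : finPoch a q n ≠ 0 :=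
  prod_ne_zero_iff.mpr fun i _ => h i

lemma summable_norm_neg_mul_pow (a : ℂ) {q : ℂ} (hq : ‖q‖ < 1) :
    Summable fun n : ℕ => ‖-(a * q ^ n)‖ := by
  simpa [norm_mul, norm_pow] using
    (summable_geometric_of_lt_one (norm_nonneg q) hq).mul_left ‖a‖

lemma tendsto_finPoch (a : ℂ) {q : ℂ} (hq : ‖q‖ < 1) :
    Tendsto (finPoch a q) atTop (𝓝 (poch a q)) := by
  have h := (multipliable_one_add_of_summable (summable_norm_neg_mul_pow a hq)).hasProd
  simp only [← sub_eq_add_neg] at h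
  exact h.tendsto_prod_nat

lemma poch_ne_zero {a q : ℂ} (hq : ‖q‖ < 1) (h : ∀ n : ℕ, 1 - a * q ^ n ≠ 0) : poch a q ≠ 0 := by
  have := tprod_one_add_ne_zero_of_summable (f := fun n : ℕ => -(a * q ^ n))
    (by simpa only [← sub_eq_add_neg] using h) (summable_norm_neg_mul_pow a hq)
  simp only [← sub_eq_add_neg] at this
  exact this

lemma prod_pow_sub_mul_pow_of_lt {p b : ℂ} (hb : b ≠ 0) (k : ℕ) :
    ∏ i ∈ range k, (p ^ k - b * p ^ i) = b ^ k * (∏ i ∈ range k, -p ^ i) * finPoch (p / b) p k := by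
  rw [← prod_range_reflect, ← prod_range_reflect (fun i => -p ^ i), finPoch,
    pow_eq_prod_const b k, ← prod_mul_distrib, ← prod_mul_distrib]
  refine prod_congr rfl fun i hi => ?_
  have hk : p ^ k = p ^ (k - 1 - i) * (p * p ^ i) := by
    rw [← pow_succ', ← pow_add]
    congr 1
    have := mem_range.mp hi
    omega
  rw [hk]
  field_simp
  ring

lemma prod_pow_sub_mul_pow_add (p c : ℂ) (k m : ℕ) :
    ∏ j ∈ range m, (p ^ k - c * p ^ (k + j)) = p ^ (k * m) * finPoch c p m := by
  rw [finPoch, pow_mul, pow_eq_prod_const (p ^ k) m, ← prod_mul_distrib]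
  exact prod_congr rfl fun i _ => by ring

lemma prod_range_erase_eq {M : Type*} [CommMonoid M] (f : ℕ → M) {k L : ℕ} (hk : k ≤ L) :
    ∏ j ∈ (range (L + 1)).erase k, f j
      = (∏ j ∈ range k, f j) * ∏ j ∈ range (L - k), f (k + 1 + j) := by
  have hs : (range (L + 1)).erase k = range k ∪ Ico (k + 1) (L + 1) := by
    ext j
    simp only [mem_erase, mem_range, mem_union, mem_Ico]
    omega
  have hd : Disjoint (range k) (Ico (k + 1) (L + 1)) := by
    rw [Finset.disjoint_left]
    intro j
    simp only [mem_range, mem_Ico]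
    omega
  rw [hs, prod_union hd, prod_Ico_eq_prod_range, Nat.add_sub_add_right]

/-- The partial fraction expansion of `(A b; p)_L / (A; p)_{L+1}` in the variable `A`. -/
lemma finPoch_div_finPoch_eq_sum {p b A : ℂ} (hp : p ≠ 0) (hp1 : ‖p‖ < 1) (hb : b ≠ 0)
    (hA : A ≠ 0) (L : ℕ) (h : ∀ i ≤ L, 1 - A * p ^ i ≠ 0) :
    finPoch (A * b) p L / finPoch A p (L + 1)
      = ∑ k ∈ range (L + 1), finPoch (p / b) p k / finPoch p p k *
          (finPoch b p (L - k) / finPoch p p (L - k)) * b ^ k / (1 - A * p ^ k) := by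
  have hinj : Function.Injective fun i : ℕ => p ^ i := by
    intro i j hij
    have hij' : ‖p‖ ^ i = ‖p‖ ^ j := by simpa using congrArg norm hij
    exact pow_right_injective₀ (norm_pos_iff.mpr hp) hp1.ne hij'
  have hx : ∀ i ∈ range (L + 1), A⁻¹ ≠ p ^ i := by
    intro i hi hAi
    apply h i (Nat.lt_succ_iff.mp (mem_range.mp hi))
    rw [← hAi, mul_inv_cancel₀ hA, sub_self]
  have hI := congrArg (Polynomial.eval A⁻¹) (Lagrange.eq_interpolate
    (f := Lagrange.nodal (range L) fun i => b * p ^ i) (s := range (L + 1))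
    (v := fun i => p ^ i) hinj.injOn (by
      rw [Lagrange.degree_nodal, card_range, card_range]
      exact_mod_cast L.lt_succ_self))
  rw [Lagrange.eval_interpolate_not_at_node _ hx, Lagrange.eval_nodal, Lagrange.eval_nodal] at hI
  have hprod (c : ℂ) (n : ℕ) : ∏ i ∈ range n, (A⁻¹ - c * p ^ i) = A⁻¹ ^ n * finPoch (A * c) p n := by
    rw [finPoch, pow_eq_prod_const A⁻¹ n, ← prod_mul_distrib]
    refine prod_congr rfl fun i _ => ?_
    field_simp
  have hprod1 := hprod 1 (L + 1)
  simp only [one_mul, mul_one] at hprod1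
  rw [hprod, hprod1] at hI
  have hne : finPoch A p (L + 1) ≠ 0 :=
    prod_ne_zero_iff.mpr fun i hi => h i (Nat.lt_succ_iff.mp (mem_range.mp hi))
  have hI' : finPoch (A * b) p L / finPoch A p (L + 1) = A⁻¹ *
      ∑ i ∈ range (L + 1), Lagrange.nodalWeight (range (L + 1)) (fun i => p ^ i) i *
        (A⁻¹ - p ^ i)⁻¹ *
        Polynomial.eval (p ^ i) (Lagrange.nodal (range L) fun i => b * p ^ i) := by
    rw [div_eq_iff hne]
    apply mul_left_cancel₀ (pow_ne_zero L (inv_ne_zero hA))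
    rw [hI]
    ring
  rw [hI', mul_sum]
  refine sum_congr rfl fun k hk => ?_
  have hkL : k ≤ L := Nat.lt_succ_iff.mp (mem_range.mp hk)
  obtain ⟨m, rfl⟩ := Nat.exists_eq_add_of_le hkL
  have hpp := finPoch_ne_zero (one_sub_mul_pow_ne_zero hp1 hp1)
  have hhead := prod_pow_sub_mul_pow_of_lt (p := p) one_ne_zero k
  simp only [one_mul, one_pow, div_one] at hhead
  have htail := prod_pow_sub_mul_pow_add p p k m
  have hden : ∏ j ∈ (range (k + m + 1)).erase k, (p ^ k - p ^ j)
      = (∏ i ∈ range k, -p ^ i) * finPoch p p k * (p ^ (k * m) * finPoch p p m) := by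
    rw [prod_range_erase_eq _ hkL, hhead, Nat.add_sub_cancel_left, ← htail]
    congr 1
    exact prod_congr rfl fun j _ => by ring
  have hD : ∏ i ∈ range k, -p ^ i ≠ 0 :=
    prod_ne_zero_iff.mpr fun i _ => neg_ne_zero.mpr (pow_ne_zero _ hp)
  have hAk : (A⁻¹ - p ^ k)⁻¹ = A / (1 - A * p ^ k) := by
    rw [← inv_div]
    congr 1
    field_simp
  rw [Lagrange.nodalWeight, prod_inv_distrib, hden, Lagrange.eval_nodal, prod_range_add,
    prod_pow_sub_mul_pow_of_lt hb, prod_pow_sub_mul_pow_add, hAk, Nat.add_sub_cancel_left]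
  have h1 := hpp k
  have h2 := hpp m
  have h3 := h k hkL
  field_simp

lemma finPoch_div_pow_add {p c : ℂ} (hp : p ≠ 0) (hc : c ≠ 0) (N M : ℕ) :
    finPoch (c / p ^ N) p (N + M)
      = c ^ N * (∏ j ∈ range N, -(p ^ (j + 1))⁻¹) * finPoch (p / c) p N * finPoch c p M := by
  rw [finPoch, prod_range_add]
  congr 1
  · rw [← prod_range_reflect, finPoch, pow_eq_prod_const c N,
      ← prod_mul_distrib, ← prod_mul_distrib]
    refine prod_congr rfl fun i hi => ?_
    have hN : p ^ N = p ^ (N - 1 - i) * (p * p ^ i) := by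
      rw [← pow_succ', ← pow_add]
      congr 1
      have := mem_range.mp hi
      omega
    rw [hN]
    field_simp
    ring
  · refine prod_congr rfl fun i _ => ?_
    field_simp
    ring

/-- A truncated form of the bilateral expansion of
`(a b, p / (a b), p, p; p)_∞ / (a, p / a, b, p / b; p)_∞`. -/
lemma finPoch_bilateral {p a b : ℂ} (hp : p ≠ 0) (hp1 : ‖p‖ < 1) (ha : a ≠ 0) (hb : b ≠ 0)
    (h : ∀ n : ℕ, 1 - a * p ^ n ≠ 0) (h' : ∀ n : ℕ, 1 - p / a * p ^ n ≠ 0) (N : ℕ) :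
    finPoch (p / (a * b)) p N * finPoch (a * b) p N
        / (finPoch (p / a) p N * finPoch a p (N + 1))
      = ∑ j ∈ range (N + 1), finPoch (p / b) p (N + j) / finPoch p p (N + j) *
          (finPoch b p (N - j) / finPoch p p (N - j)) * (b ^ j / (1 - a * p ^ j))
        + ∑ j ∈ range N, finPoch (p / b) p (N - 1 - j) / finPoch p p (N - 1 - j) *
          (finPoch b p (N + 1 + j) / finPoch p p (N + 1 + j)) *
          (-(a⁻¹ * (p / b) ^ (j + 1)) / (1 - p / a * p ^ j)) := by
  have hlow (j : ℕ) (hj : j < N) :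
      1 - a / p ^ N * p ^ (N - 1 - j) = -(a / p ^ (j + 1)) * (1 - p / a * p ^ j) := by
    have hN : p ^ N = p ^ (N - 1 - j) * (p * p ^ j) := by
      rw [← pow_succ', ← pow_add]
      congr 1
      omega
    rw [hN]
    field_simp
    ring
  have hhigh (j : ℕ) : 1 - a / p ^ N * p ^ (N + j) = 1 - a * p ^ j := by
    field_simp
    ring
  have hA : ∀ i ≤ N + N, 1 - a / p ^ N * p ^ i ≠ 0 := by
    intro i _
    rcases lt_or_ge i N with hi | hi
    · have := hlow (N - 1 - i) (by omega)
      rw [show N - 1 - (N - 1 - i) = i by omega] at this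
      rw [this]
      exact mul_ne_zero (neg_ne_zero.mpr (div_ne_zero ha (pow_ne_zero _ hp))) (h' _)
    · obtain ⟨j, rfl⟩ := Nat.exists_eq_add_of_le hi
      rw [hhigh]
      exact h j
  have key := finPoch_div_finPoch_eq_sum hp hp1 hb (div_ne_zero ha (pow_ne_zero N hp)) (N + N) hA
  rw [div_mul_eq_mul_div, finPoch_div_pow_add hp (mul_ne_zero ha hb), add_assoc,
    finPoch_div_pow_add hp ha, sum_range_add, ← sum_range_reflect, add_comm (∑ _ ∈ _, _)] at key
  have hD : ∏ j ∈ range N, -(p ^ (j + 1))⁻¹ ≠ 0 :=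
    prod_ne_zero_iff.mpr fun i _ => neg_ne_zero.mpr (inv_ne_zero (pow_ne_zero _ hp))
  have h1 := finPoch_ne_zero h (N + 1)
  have h2 := finPoch_ne_zero h' N
  apply mul_left_cancel₀ (pow_ne_zero N hb)
  trans (a * b) ^ N * (∏ j ∈ range N, -(p ^ (j + 1))⁻¹) * finPoch (p / (a * b)) p N
      * finPoch (a * b) p N / (a ^ N * (∏ j ∈ range N, -(p ^ (j + 1))⁻¹) * finPoch (p / a) p N
      * finPoch a p (N + 1))
  · generalize ∏ j ∈ range N, -(p ^ (j + 1))⁻¹ = D at hD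
    rw [mul_pow]
    field_simp
  rw [key, mul_add, mul_sum, mul_sum]
  congr 1
  · refine sum_congr rfl fun j _ => ?_
    rw [hhigh, Nat.add_sub_add_left, pow_add]
    ring
  · refine sum_congr rfl fun j hj => ?_
    have hj' := mem_range.mp hj
    have hbN : b ^ N = b ^ (N - 1 - j) * b ^ (j + 1) := by
      rw [← pow_add]
      congr 1
      omega
    rw [hlow j hj', show N + N - (N - 1 - j) = N + 1 + j by omega, hbN, div_pow]
    have h3 := h' j
    field_simp

lemma tendsto_sum_range_mul {c : ℕ → ℕ → ℂ} {u : ℕ → ℂ} {l : ℂ} {C : ℝ} {M : ℕ → ℕ}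
    (hu : Summable fun n => ‖u n‖) (hc : ∀ n, Tendsto (fun N => c N n) atTop (𝓝 l))
    (hC : ∀ N n, ‖c N n‖ ≤ C) (hM : Tendsto M atTop atTop) :
    Tendsto (fun N => ∑ n ∈ range (M N), c N n * u n) atTop (𝓝 (l * ∑' n, u n)) := by
  have h := tendsto_tsum_of_dominated_convergence (𝓕 := atTop)
    (f := fun N n => if n ∈ range (M N) then c N n * u n else 0)
    (g := fun n => l * u n) (bound := fun n => C * ‖u n‖) (hu.mul_left C) ?_ ?_
  · rw [tsum_mul_left] at h
    refine h.congr fun N => ?_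
    rw [tsum_eq_sum (s := range (M N)) fun n hn => if_neg hn]
    exact sum_congr rfl fun n hn => if_pos hn
  · intro n
    refine ((hc n).mul_const (u n)).congr' ?_
    filter_upwards [hM.eventually_gt_atTop n] with N hN
    rw [if_pos (mem_range.mpr hN)]
  · refine Eventually.of_forall fun N n => ?_
    split_ifs
    · rw [norm_mul]
      exact mul_le_mul_of_nonneg_right (hC N n) (norm_nonneg _)
    · rw [norm_zero]
      exact mul_nonneg ((norm_nonneg _).trans (hC 0 0)) (norm_nonneg _)

lemma summable_norm_pow_div {x a p : ℂ} (hx : ‖x‖ < 1) (hp1 : ‖p‖ < 1) :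
    Summable fun n : ℕ => ‖x ^ n / (1 - a * p ^ n)‖ := by
  have hlim : Tendsto (fun n : ℕ => (1 - a * p ^ n)⁻¹) atTop (𝓝 1) := by
    have := ((tendsto_pow_atTop_nhds_zero_of_norm_lt_one hp1).const_mul a).const_sub 1
    simpa using this.inv₀ (by simp)
  obtain ⟨C, hC⟩ := hlim.norm.bddAbove_range
  refine Summable.of_nonneg_of_le (fun _ => norm_nonneg _) (fun n => ?_)
    ((summable_geometric_of_lt_one (norm_nonneg x) hx).mul_left C)
  rw [div_eq_mul_inv, norm_mul, norm_pow, mul_comm]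
  exact mul_le_mul_of_nonneg_right (hC ⟨n, rfl⟩) (by positivity)

/-- Kronecker's bilateral Lambert series as a product. -/
theorem tsum_sub_tsum_eq_poch_div {p a b : ℂ} (hp : p ≠ 0) (ha : a ≠ 0) (hpb : ‖p‖ < ‖b‖)
    (hb1 : ‖b‖ < 1) (h : ∀ n : ℕ, 1 - a * p ^ n ≠ 0) (h' : ∀ n : ℕ, 1 - p / a * p ^ n ≠ 0) :
    (∑' n : ℕ, b ^ n / (1 - a * p ^ n))
        - ∑' n : ℕ, a⁻¹ * (p / b) ^ (n + 1) / (1 - p / a * p ^ n)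
      = (poch (a * b) p * poch (p / (a * b)) p * poch p p * poch p p)
        / (poch a p * poch (p / a) p * poch b p * poch (p / b) p) := by
  have hp1 : ‖p‖ < 1 := hpb.trans hb1
  have hb : b ≠ 0 := norm_pos_iff.mp ((norm_nonneg p).trans_lt hpb)
  have hpb1 : ‖p / b‖ < 1 := by
    rw [norm_div, div_lt_one (norm_pos_iff.mpr hb)]
    exact hpb
  have hpp := poch_ne_zero hp1 (one_sub_mul_pow_ne_zero hp1 hp1)
  have hB := poch_ne_zero hp1 (one_sub_mul_pow_ne_zero hb1 hp1)
  have hB' := poch_ne_zero hp1 (one_sub_mul_pow_ne_zero hpb1 hp1)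
  have hA := poch_ne_zero hp1 h
  have hA' := poch_ne_zero hp1 h'
  have hG := (tendsto_finPoch (p / b) hp1).div (tendsto_finPoch p hp1) hpp
  have hH := (tendsto_finPoch b hp1).div (tendsto_finPoch p hp1) hpp
  obtain ⟨C, hC⟩ := hG.norm.bddAbove_range
  obtain ⟨D, hD⟩ := hH.norm.bddAbove_range
  have hCD (i j : ℕ) : ‖finPoch (p / b) p i / finPoch p p i * (finPoch b p j / finPoch p p j)‖
      ≤ C * D := by
    rw [norm_mul]
    exact mul_le_mul (hC ⟨i, rfl⟩) (hD ⟨j, rfl⟩) (norm_nonneg _)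
      ((norm_nonneg _).trans (hC ⟨i, rfl⟩))
  have hL : Tendsto (fun N => finPoch (p / (a * b)) p N * finPoch (a * b) p N
      / (finPoch (p / a) p N * finPoch a p (N + 1))) atTop
      (𝓝 (poch (p / (a * b)) p * poch (a * b) p / (poch (p / a) p * poch a p))) :=
    ((tendsto_finPoch _ hp1).mul (tendsto_finPoch _ hp1)).div
      ((tendsto_finPoch _ hp1).mul ((tendsto_finPoch _ hp1).comp (tendsto_add_atTop_nat 1)))
      (mul_ne_zero hA' hA)
  have hS₁ := tendsto_sum_range_mul
    (c := fun N j => finPoch (p / b) p (N + j) / finPoch p p (N + j) *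
      (finPoch b p (N - j) / finPoch p p (N - j)))
    (summable_norm_pow_div (a := a) hb1 hp1)
    (fun n => (hG.comp (tendsto_add_atTop_nat n)).mul (hH.comp (tendsto_sub_atTop_nat n)))
    (fun N n => hCD _ _) (tendsto_add_atTop_nat 1)
  have hu : Summable fun j : ℕ => ‖-(a⁻¹ * (p / b) ^ (j + 1)) / (1 - p / a * p ^ j)‖ := by
    refine ((summable_norm_pow_div (a := p / a) hpb1 hp1).mul_left ‖a⁻¹ * (p / b)‖).congr
      fun j => ?_
    rw [← norm_mul, ← norm_neg]
    congr 1
    ring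
  have hS₂ := tendsto_sum_range_mul
    (c := fun N j => finPoch (p / b) p (N - 1 - j) / finPoch p p (N - 1 - j) *
      (finPoch b p (N + 1 + j) / finPoch p p (N + 1 + j)))
    hu
    (fun n => (hG.comp ((tendsto_sub_atTop_nat n).comp (tendsto_sub_atTop_nat 1))).mul
      (hH.comp ((tendsto_add_atTop_nat n).comp (tendsto_add_atTop_nat 1))))
    (fun N n => hCD _ _) tendsto_id
  have hlim := tendsto_nhds_unique (hL.congr fun N =>
    finPoch_bilateral hp hp1 ha hb h h' N) (hS₁.add hS₂)
  simp only [neg_div, tsum_neg] at hlim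
  rw [← mul_add, ← sub_eq_add_neg] at hlim
  apply mul_left_cancel₀ (mul_ne_zero (div_ne_zero hB' hpp) (div_ne_zero hB hpp))
  rw [← hlim]
  field_simp

/-- Identity (2.3):
`∑_{n≥0} qⁿ/(1 − q^{5n+1}) − ∑_{n≥0} q^{4n+3}/(1 − q^{5n+4})
  = (q², q³, q⁵, q⁵; q⁵)_∞ / (q, q, q⁴, q⁴; q⁵)_∞` for `|q| < 1`. -/
theorem statement_6 (q : ℂ) (hq : ‖q‖ < 1) :
    (∑' n : ℕ, q ^ n / (1 - q ^ (5 * n + 1)))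
      - ∑' n : ℕ, q ^ (4 * n + 3) / (1 - q ^ (5 * n + 4))
    = (poch (q ^ 2) (q ^ 5) * poch (q ^ 3) (q ^ 5)
        * poch (q ^ 5) (q ^ 5) * poch (q ^ 5) (q ^ 5))
      / (poch q (q ^ 5) * poch q (q ^ 5)
        * poch (q ^ 4) (q ^ 5) * poch (q ^ 4) (q ^ 5)) := by
  rcases eq_or_ne q 0 with rfl | hq0
  · rw [tsum_eq_single 0 (by simp +contextual)]
    simp [poch]
  have hpos : 0 < ‖q‖ := norm_pos_iff.mpr hq0
  have hp1 : ‖q ^ 5‖ < 1 := by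
    rw [norm_pow]
    exact pow_lt_one₀ hpos.le hq (by norm_num)
  have h4 : q ^ 5 / q = q ^ 4 := by field_simp
  have h3 : q ^ 5 / (q * q) = q ^ 3 := by field_simp
  have hq4 : ‖q ^ 4‖ < 1 := by
    rw [norm_pow]
    exact pow_lt_one₀ hpos.le hq (by norm_num)
  have hpq : ‖q ^ 5‖ < ‖q‖ := by
    rw [norm_pow]
    exact pow_lt_self_of_lt_one₀ hpos hq (by norm_num)
  have key := tsum_sub_tsum_eq_poch_div (pow_ne_zero 5 hq0) hq0 hpq hq
    (one_sub_mul_pow_ne_zero hq hp1) (by rw [h4]; exact one_sub_mul_pow_ne_zero hq4 hp1)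
  rw [h3, h4, ← sq] at key
  convert key using 1
  · congr 1
    · refine tsum_congr fun n => ?_
      congr 2
      ring
    · refine tsum_congr fun n => ?_
      congr 1
      · field_simp
        ring
      · ring
  · congr 1
    ring

end Beck
end

section
/- For every complex q with 0 < |q| < 1: ∑_{n≥1} (q^n + q^{2n} − q^{3n} − q^{4n})/(1 − q^{5n}) = (2/5)·(q^2, q^3, q^5; q^5)_∞^2 / (q, q^4; q^5)_∞^3 − (q/5)·(q, q^4, q^5; q^5)_∞^2 / (q^2, q^3; q^5)_∞^3 − 2/5. -/
/-!
Common definitions: for a partition `π` of `n`,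
`numParts` is the number of parts, `largestPart` the largest part,
`omegaOnes` the number of parts equal to 1, `rank` and `crank` the
Dyson rank and Andrews–Garvan crank.  `NT m j n` is the total number of
parts over partitions of `n` with rank ≡ m (mod j), and `Mw m j n` is
the total number of ones over partitions of `n` with crank ≡ m (mod j).
`poch a q = (a; q)_∞ = ∏_{n ≥ 0} (1 - a qⁿ)`.
-/

namespace Beck

section

open Filter Topology Set

/-- If `N` and `M` are holomorphic on `ℂ \ {0}` with the same factor of automorphy under
`z ↦ Q z`, the zeros of `M` are simple and `N` vanishes at all of them, then `N` is a constant
multiple of `M`. -/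
theorem exists_const_of_quasiperiodic {Q : ℂ} (hQ0 : Q ≠ 0) (hQ : ‖Q‖ < 1) {N M μ : ℂ → ℂ}
    (hN : DifferentiableOn ℂ N {0}ᶜ) (hM : DifferentiableOn ℂ M {0}ᶜ)
    (hμ : ∀ z ≠ 0, μ z ≠ 0)
    (hNQ : ∀ z ≠ 0, N (Q * z) = μ z * N z) (hMQ : ∀ z ≠ 0, M (Q * z) = μ z * M z)
    (hsimple : ∀ z ≠ 0, M z = 0 → deriv M z ≠ 0) (hzero : ∀ z ≠ 0, M z = 0 → N z = 0) :
    ∃ C : ℂ, ∀ z ≠ 0, N z = C * M z := by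
  have hopen : IsOpen ({0}ᶜ : Set ℂ) := isOpen_compl_singleton
  set h : ℂ → ℂ := fun z ↦ if M z = 0 then deriv N z / deriv M z else N z / M z with hh
  have hne : ∀ z ≠ 0, ∀ᶠ w in 𝓝[≠] z, M w ≠ 0 := by
    intro z hz
    by_cases hMz : M z = 0
    · have hd := (hM.differentiableAt (hopen.mem_nhds hz)).hasDerivAt
      simpa [hMz] using hd.eventually_ne (hsimple z hz hMz) (c := 0)
    · exact ((hM.differentiableAt (hopen.mem_nhds hz)).continuousAt.eventually_ne hMz).filter_mono
        nhdsWithin_le_nhds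
  have hdiff : DifferentiableOn ℂ h {0}ᶜ := by
    intro z hz
    apply DifferentiableAt.differentiableWithinAt
    have hNz := hN.differentiableAt (hopen.mem_nhds hz)
    have hMz := hM.differentiableAt (hopen.mem_nhds hz)
    by_cases h0 : M z = 0
    · have hN' : DifferentiableAt ℂ (dslope N z) z :=
        ((Complex.differentiableOn_dslope (hopen.mem_nhds hz)).2 hN).differentiableAt
          (hopen.mem_nhds hz)
      have hM' : DifferentiableAt ℂ (dslope M z) z :=
        ((Complex.differentiableOn_dslope (hopen.mem_nhds hz)).2 hM).differentiableAt
          (hopen.mem_nhds hz)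
      have hds : dslope M z z ≠ 0 := by simpa using hsimple z hz h0
      refine (hN'.div hM' hds).congr_of_eventuallyEq ?_
      have := eventually_nhdsWithin_iff.1 (hne z hz)
      filter_upwards [this] with w hw
      by_cases hwz : w = z
      · subst hwz; simp [hh, h0]
      · have hw0 := hw hwz
        have hs : w - z ≠ 0 := sub_ne_zero.2 hwz
        have e1 := sub_smul_dslope N z w
        have e2 := sub_smul_dslope M z w
        rw [hzero z hz h0, sub_zero, smul_eq_mul] at e1
        rw [h0, sub_zero, smul_eq_mul] at e2
        simp only [hh, if_neg hw0, Pi.div_apply]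
        rw [← e1, ← e2, mul_div_mul_left _ _ hs]
    · refine (hNz.div hMz h0).congr_of_eventuallyEq ?_
      filter_upwards [hMz.continuousAt.eventually_ne h0] with w hw
      simp [hh, hw]
  have hper : ∀ z ≠ 0, h (Q * z) = h z := by
    intro z hz
    have hQz : Q * z ≠ 0 := mul_ne_zero hQ0 hz
    have c1 : ContinuousAt (fun w ↦ h (Q * w)) z :=
      ContinuousAt.comp' (hdiff.differentiableAt (hopen.mem_nhds hQz)).continuousAt (by fun_prop)
    have c2 : ContinuousAt h z := (hdiff.differentiableAt (hopen.mem_nhds hz)).continuousAt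
    refine ((c1.eventuallyEq_nhds_iff_eventuallyEq_nhdsNE c2).1 ?_).self_of_nhds
    have hz' : ∀ᶠ w in 𝓝[≠] z, w ≠ 0 :=
      (continuousAt_id.eventually_ne hz).filter_mono nhdsWithin_le_nhds
    filter_upwards [hne z hz, hz'] with w hw hw0
    have hμw := hμ w hw0
    simp only [hh, hMQ w hw0, hNQ w hw0, mul_eq_zero, hμw, hw, or_self, if_false]
    rw [mul_div_mul_left _ _ hμw]
  have hQpos : 0 < ‖Q‖ := norm_pos_iff.2 hQ0
  have hperz : ∀ k : ℤ, ∀ z ≠ 0, h (Q ^ k * z) = h z := by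
    intro k
    induction k with
    | zero => simp
    | succ n ih =>
      intro z hz
      rw [zpow_add_one₀ hQ0, mul_assoc, ih _ (mul_ne_zero hQ0 hz), hper z hz]
    | pred n ih =>
      intro z hz
      have := ih z hz
      rw [← this, ← hper (Q ^ (-(n : ℤ) - 1) * z) (mul_ne_zero (zpow_ne_zero _ hQ0) hz),
        zpow_sub_one₀ hQ0]
      congr 1
      field_simp
  set K : Set ℂ := {z | ‖Q‖ ≤ ‖z‖ ∧ ‖z‖ ≤ 1} with hK
  have hK0 : K ⊆ {0}ᶜ := by
    intro z hz h0
    rw [mem_singleton_iff] at h0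
    subst h0
    simp [hK] at hz
    exact hQ0 hz
  have hKc : IsCompact K := by
    refine Metric.isCompact_of_isClosed_isBounded ?_ ?_
    · exact (isClosed_le continuous_const continuous_norm).inter
        (isClosed_le continuous_norm continuous_const)
    · exact (Metric.isBounded_closedBall (x := (0 : ℂ)) (r := 1)).subset
        fun z hz ↦ by simpa using hz.2
  obtain ⟨c, hcK, hc⟩ := hKc.exists_isMaxOn ⟨1, by simp [hK, hQ.le]⟩
    ((hdiff.continuousOn.mono hK0).norm)
  have hmax : IsMaxOn (norm ∘ h) {0}ᶜ c := by
    intro z hz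
    obtain ⟨k, hk1, hk2⟩ := exists_mem_Ioc_zpow (x := ‖z‖) (norm_pos_iff.2 hz)
      ((one_lt_inv₀ hQpos).2 hQ)
    have : Q ^ (k + 1) * z ∈ K := by
      rw [inv_zpow] at hk1 hk2
      have hp : 0 < ‖Q‖ ^ k := zpow_pos hQpos _
      constructor
      · rw [norm_mul, norm_zpow, zpow_add_one₀ hQpos.ne']
        have := (inv_lt_iff_one_lt_mul₀ hp).1 hk1
        nlinarith
      · rw [norm_mul, norm_zpow]
        simpa [(zpow_pos hQpos (k + 1)).ne'] using
          mul_le_mul_of_nonneg_left hk2 (zpow_pos hQpos (k + 1)).le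
    have h1 := hc this
    simp only [mem_ofPred_eq, hperz _ z hz] at h1
    exact h1
  have hconst := Complex.eqOn_of_isPreconnected_of_isMaxOn_norm
    (isConnected_compl_singleton_of_one_lt_rank (by simp) (0 : ℂ)).isPreconnected hopen hdiff
    (hK0 hcK) hmax
  refine ⟨h c, fun z hz ↦ ?_⟩
  by_cases h0 : M z = 0
  · rw [h0, hzero z hz h0, mul_zero]
  · have hz' : h z = h c := hconst hz
    rw [← hz', hh]
    simp only [if_neg h0]
    rw [div_mul_cancel₀ _ h0]

theorem summable_norm_mul_pow {Q : ℂ} (hQ : ‖Q‖ < 1) (z : ℂ) :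
    Summable fun n : ℕ ↦ ‖-(z * Q ^ n)‖ := by
  simpa using (summable_geometric_of_lt_one (norm_nonneg _) hQ).mul_left ‖z‖

theorem poch_eq_one_sub_mul {Q : ℂ} (hQ : ‖Q‖ < 1) (z : ℂ) :
    poch z Q = (1 - z) * poch (Q * z) Q := by
  have h : Multipliable fun n : ℕ ↦ 1 + -(Q * z * Q ^ n) :=
    multipliable_one_add_of_summable (summable_norm_mul_pow hQ (Q * z))
  have e (n : ℕ) : 1 - z * Q ^ (n + 1) = 1 + -(Q * z * Q ^ n) := by ring
  have h' : Multipliable fun n : ℕ ↦ 1 - z * Q ^ (n + 1) := by simpa only [e] using h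
  have := tprod_eq_zero_mul' (f := fun n : ℕ ↦ 1 - z * Q ^ n) h'
  rw [poch, this, poch]
  simp only [e, pow_zero, mul_one, sub_eq_add_neg]

theorem poch_ne_zero_s15 {Q : ℂ} (hQ : ‖Q‖ < 1) {z : ℂ} (h : ∀ n : ℕ, z * Q ^ n ≠ 1) :
    poch z Q ≠ 0 := by
  have := tprod_one_add_ne_zero_of_summable (f := fun n : ℕ ↦ -(z * Q ^ n))
    (fun n h0 ↦ h n (by linear_combination -h0)) (summable_norm_mul_pow hQ z)
  simpa only [poch, sub_eq_add_neg] using this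

theorem multipliableLocallyUniformlyOn_poch {Q : ℂ} (hQ : ‖Q‖ < 1) :
    MultipliableLocallyUniformlyOn (fun (n : ℕ) (z : ℂ) ↦ 1 - z * Q ^ n) univ := by
  refine ⟨fun z ↦ poch z Q, hasProdLocallyUniformlyOn_of_forall_compact isOpen_univ ?_⟩
  intro K _ hK
  obtain ⟨R, hR⟩ := hK.isBounded.exists_norm_le
  simp only [poch, sub_eq_add_neg]
  refine ((summable_geometric_of_lt_one (norm_nonneg Q) hQ).mul_left R).hasProdUniformlyOn_nat_one_add
    hK (.of_forall fun n z hz ↦ ?_) (fun n ↦ by fun_prop)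
  rw [norm_neg, norm_mul, norm_pow]
  gcongr
  exact hR z hz

theorem differentiable_poch {Q : ℂ} (hQ : ‖Q‖ < 1) : Differentiable ℂ fun z ↦ poch z Q := by
  rw [← differentiableOn_univ]
  exact (multipliableLocallyUniformlyOn_poch hQ).hasProdLocallyUniformlyOn.differentiableOn
    (.of_forall fun _ ↦ by simpa [Finset.prod_fn] using
      DifferentiableOn.finsetProd (fun _ _ ↦ by fun_prop)) isOpen_univ

theorem summable_lambert {Q : ℂ} (hQ : ‖Q‖ < 1) {y : ℂ} (hy : ‖y‖ < 1) :
    Summable fun p : ℕ × ℕ ↦ (y * Q ^ p.1) ^ (p.2 + 1) := by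
  have h := (summable_geometric_of_lt_one (norm_nonneg Q) hQ).mul_of_nonneg
    ((summable_nat_add_iff 1).2 (summable_geometric_of_lt_one (norm_nonneg y) hy))
    (fun _ ↦ by positivity) (fun _ ↦ by positivity)
  refine .of_norm_bounded h fun p ↦ ?_
  rw [mul_pow, norm_mul, norm_pow, norm_pow, norm_pow, mul_comm, ← pow_mul]
  gcongr ?_ * _
  exact pow_le_pow_of_le_one (norm_nonneg _) hQ.le (Nat.le_mul_of_pos_right _ p.2.succ_pos)

theorem hasSum_pow_succ {w : ℂ} (hw : ‖w‖ < 1) :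
    HasSum (fun m : ℕ ↦ w ^ (m + 1)) (w / (1 - w)) := by
  simpa [pow_succ', div_eq_mul_inv] using (hasSum_geometric_of_norm_lt_one hw).mul_left w

theorem norm_mul_pow_lt_one {Q : ℂ} (hQ : ‖Q‖ < 1) {y : ℂ} (hy : ‖y‖ < 1) (n : ℕ) :
    ‖y * Q ^ n‖ < 1 := by
  rw [norm_mul, norm_pow]
  exact mul_lt_one_of_nonneg_of_lt_one_left (norm_nonneg _) hy (pow_le_one₀ (norm_nonneg _) hQ.le)

theorem summable_lambert_left {Q : ℂ} (hQ : ‖Q‖ < 1) {y : ℂ} (hy : ‖y‖ < 1) :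
    Summable fun n : ℕ ↦ y * Q ^ n / (1 - y * Q ^ n) := by
  have := (summable_lambert hQ hy).prod
  simpa only [(hasSum_pow_succ (norm_mul_pow_lt_one hQ hy _)).tsum_eq] using this

/-- The Lambert series `∑ y Qⁿ / (1 - y Qⁿ)` rewritten by interchanging summations. -/
theorem hasSum_lambert {Q : ℂ} (hQ : ‖Q‖ < 1) {y : ℂ} (hy : ‖y‖ < 1) :
    HasSum (fun m : ℕ ↦ y ^ (m + 1) / (1 - Q ^ (m + 1)))
      (∑' n : ℕ, y * Q ^ n / (1 - y * Q ^ n)) := by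
  have h := summable_lambert hQ hy
  have h1 (m : ℕ) : HasSum (fun n : ℕ ↦ (y * Q ^ n) ^ (m + 1))
      (y ^ (m + 1) / (1 - Q ^ (m + 1))) := by
    have hQm : ‖Q ^ (m + 1)‖ < 1 := by
      rw [norm_pow]; exact pow_lt_one₀ (norm_nonneg _) hQ m.succ_ne_zero
    simpa only [mul_pow, ← pow_mul, mul_comm (m + 1), div_eq_mul_inv] using
      (hasSum_geometric_of_norm_lt_one hQm).mul_left (y ^ (m + 1))
  have h2 : ∑' n : ℕ, y * Q ^ n / (1 - y * Q ^ n) = ∑' p : ℕ × ℕ, (y * Q ^ p.1) ^ (p.2 + 1) := by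
    rw [h.tsum_prod]
    exact tsum_congr fun n ↦ (hasSum_pow_succ (norm_mul_pow_lt_one hQ hy n)).tsum_eq.symm
  rw [h2, ← (Equiv.prodComm ℕ ℕ).tsum_eq]
  exact ((Equiv.prodComm ℕ ℕ).summable_iff.2 h).hasSum.prod_fiberwise h1

theorem mul_logDeriv_poch {Q : ℂ} (hQ : ‖Q‖ < 1) {y : ℂ} (hy : ‖y‖ < 1) :
    y * logDeriv (fun z ↦ poch z Q) y = -∑' m : ℕ, y ^ (m + 1) / (1 - Q ^ (m + 1)) := by
  have hne (n : ℕ) : y * Q ^ n ≠ 1 := fun h ↦ by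
    simpa [h] using norm_mul_pow_lt_one hQ hy n
  have hld (n : ℕ) : logDeriv (fun z ↦ 1 - z * Q ^ n) y = -(Q ^ n / (1 - y * Q ^ n)) := by
    simp [logDeriv_apply, neg_div]
  have hterm (n : ℕ) : y * logDeriv (fun z ↦ 1 - z * Q ^ n) y
      = -(y * Q ^ n / (1 - y * Q ^ n)) := by rw [hld]; ring
  rcases eq_or_ne y 0 with rfl | hy0
  · simp
  have hsum : Summable fun n : ℕ ↦ logDeriv (fun z ↦ 1 - z * Q ^ n) y := by
    rw [← summable_mul_left_iff hy0]
    simp only [hterm]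
    exact (summable_lambert_left hQ hy).neg
  have := logDeriv_tprod_eq_tsum (f := fun (n : ℕ) (z : ℂ) ↦ 1 - z * Q ^ n) isOpen_univ (mem_univ y)
    (fun n ↦ sub_ne_zero.2 (hne n).symm) (fun n ↦ by fun_prop) hsum
    (multipliableLocallyUniformlyOn_poch hQ) (poch_ne_zero_s15 hQ hne)
  simp only [poch]
  rw [this, ← tsum_mul_left, (hasSum_lambert hQ hy).tsum_eq, ← tsum_neg]
  exact tsum_congr hterm

/-- The theta function `(z; Q)_∞ (Q/z; Q)_∞`. -/
noncomputable def theta (Q z : ℂ) : ℂ := poch z Q * poch (Q / z) Q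

theorem differentiableOn_theta {Q : ℂ} (hQ : ‖Q‖ < 1) : DifferentiableOn ℂ (theta Q) {0}ᶜ := by
  refine (differentiable_poch hQ).differentiableOn.mul ?_
  exact (differentiable_poch hQ).comp_differentiableOn
    (DifferentiableOn.div (by fun_prop) (by fun_prop) fun z hz ↦ hz)

theorem differentiableAt_theta {Q : ℂ} (hQ : ‖Q‖ < 1) {z : ℂ} (hz : z ≠ 0) :
    DifferentiableAt ℂ (theta Q) z :=
  (differentiableOn_theta hQ).differentiableAt (isOpen_compl_singleton.mem_nhds hz)

theorem theta_mul_left {Q : ℂ} (hQ0 : Q ≠ 0) (hQ : ‖Q‖ < 1) {z : ℂ} (hz : z ≠ 0) :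
    theta Q (Q * z) = -(theta Q z / z) := by
  have h : poch (Q / (Q * z)) Q = (1 - 1 / z) * poch (Q / z) Q := by
    rw [poch_eq_one_sub_mul hQ]
    congr 2 <;> field_simp
  rw [theta, theta, h, poch_eq_one_sub_mul hQ z]
  field_simp
  ring

theorem theta_inv {Q : ℂ} (hQ : ‖Q‖ < 1) {z : ℂ} (hz : z ≠ 0) :
    theta Q z⁻¹ = -(theta Q z / z) := by
  rw [theta, theta, poch_eq_one_sub_mul hQ z, poch_eq_one_sub_mul hQ z⁻¹]
  simp only [div_inv_eq_mul, ← div_eq_mul_inv]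
  field_simp
  ring

theorem theta_one {Q : ℂ} (hQ : ‖Q‖ < 1) : theta Q 1 = 0 := by
  rw [theta, poch_eq_one_sub_mul hQ]
  simp

theorem hasDerivAt_theta_one {Q : ℂ} (hQ : ‖Q‖ < 1) :
    HasDerivAt (theta Q) (-poch Q Q ^ 2) 1 := by
  have h : DifferentiableAt ℂ (fun z ↦ poch (Q * z) Q * poch (Q / z) Q) 1 :=
    ((differentiable_poch hQ).comp (g := fun z ↦ poch z Q) (by fun_prop :
      Differentiable ℂ fun z ↦ Q * z)).differentiableAt.mul
      (DifferentiableAt.comp (1 : ℂ) (g := fun z ↦ poch z Q) (differentiable_poch hQ _)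
        (DifferentiableAt.div (by fun_prop) (by fun_prop) one_ne_zero))
  have h1 : HasDerivAt (fun z : ℂ ↦ 1 - z) (-1) 1 := by
    simpa using (hasDerivAt_id (1 : ℂ)).const_sub 1
  have h2 := h1.mul h.hasDerivAt
  refine (h2.congr_deriv (by simp; ring)).congr_of_eventuallyEq (.of_forall fun z ↦ ?_)
  simp only [theta, Pi.mul_apply]
  rw [poch_eq_one_sub_mul hQ z, mul_assoc]

theorem exists_zpow_eq_of_theta_eq_zero {Q : ℂ} (hQ0 : Q ≠ 0) (hQ : ‖Q‖ < 1) {z : ℂ}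
    (hz : z ≠ 0) (h : theta Q z = 0) : ∃ k : ℤ, z = Q ^ k := by
  by_contra! hk
  refine mul_ne_zero (poch_ne_zero_s15 hQ fun n hn ↦ hk (-n) ?_)
    (poch_ne_zero_s15 hQ fun n hn ↦ hk (n + 1) ?_) h
  · rw [zpow_neg, zpow_natCast]
    exact eq_inv_of_mul_eq_one_left hn
  · have : z = Q * Q ^ n := by field_simp at hn; exact hn.symm
    rw [this, zpow_add_one₀ hQ0, zpow_natCast, mul_comm]

/-- The Euler derivative `z θ'(z)` of the theta function. -/
noncomputable def thetaEuler (Q z : ℂ) : ℂ := z * deriv (theta Q) z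

theorem differentiableOn_thetaEuler {Q : ℂ} (hQ : ‖Q‖ < 1) :
    DifferentiableOn ℂ (thetaEuler Q) {0}ᶜ :=
  differentiableOn_id.mul ((differentiableOn_theta hQ).deriv isOpen_compl_singleton)

theorem thetaEuler_one {Q : ℂ} (hQ : ‖Q‖ < 1) : thetaEuler Q 1 = -poch Q Q ^ 2 := by
  rw [thetaEuler, (hasDerivAt_theta_one hQ).deriv, one_mul]

theorem hasDerivAt_neg_theta_div {Q : ℂ} (hQ : ‖Q‖ < 1) {z : ℂ} (hz : z ≠ 0) :
    HasDerivAt (fun w ↦ -(theta Q w / w)) (-((thetaEuler Q z - theta Q z) / z ^ 2)) z := by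
  refine (((differentiableAt_theta hQ hz).hasDerivAt.div (hasDerivAt_id z) hz).neg).congr_deriv ?_
  simp [thetaEuler, mul_comm]

theorem thetaEuler_mul_left {Q : ℂ} (hQ0 : Q ≠ 0) (hQ : ‖Q‖ < 1) {z : ℂ} (hz : z ≠ 0) :
    thetaEuler Q (Q * z) = -((thetaEuler Q z - theta Q z) / z) := by
  have h1 : HasDerivAt (fun w ↦ theta Q (Q * w)) (deriv (theta Q) (Q * z) * Q) z :=
    HasDerivAt.comp z (differentiableAt_theta hQ (mul_ne_zero hQ0 hz)).hasDerivAt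
      (by simpa using (hasDerivAt_id z).const_mul Q)
  have h2 := h1.unique ((hasDerivAt_neg_theta_div hQ hz).congr_of_eventuallyEq
    ((eventually_ne_nhds hz).mono fun w hw ↦ theta_mul_left hQ0 hQ hw))
  rw [thetaEuler, show Q * z * deriv (theta Q) (Q * z) = z * (deriv (theta Q) (Q * z) * Q) by ring,
    h2]
  field_simp

theorem thetaEuler_inv {Q : ℂ} (hQ : ‖Q‖ < 1) {z : ℂ} (hz : z ≠ 0) :
    thetaEuler Q z⁻¹ = (thetaEuler Q z - theta Q z) / z := by
  have h1 : HasDerivAt (fun w ↦ theta Q w⁻¹) (deriv (theta Q) z⁻¹ * -(z ^ 2)⁻¹) z :=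
    HasDerivAt.comp z (differentiableAt_theta hQ (inv_ne_zero hz)).hasDerivAt (hasDerivAt_inv hz)
  have h2 := h1.unique ((hasDerivAt_neg_theta_div hQ hz).congr_of_eventuallyEq
    ((eventually_ne_nhds hz).mono fun w hw ↦ theta_inv hQ hw))
  have h3 : thetaEuler Q z⁻¹ = -z * (deriv (theta Q) z⁻¹ * -(z ^ 2)⁻¹) := by
    rw [thetaEuler]; field_simp
  rw [h3, h2]
  field_simp

theorem zpow_mul_induction {Q : ℂ} (hQ0 : Q ≠ 0) {p : ℂ → Prop}
    (hp : ∀ z ≠ 0, p (Q * z) ↔ p z) {a : ℂ} (ha : a ≠ 0) (hpa : p a) (k : ℤ) : p (Q ^ k * a) := by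
  induction k with
  | zero => simpa
  | succ n ih =>
    rw [zpow_add_one₀ hQ0, mul_comm _ Q, mul_assoc]
    exact (hp _ (mul_ne_zero (zpow_ne_zero _ hQ0) ha)).2 ih
  | pred n ih =>
    rw [← hp _ (mul_ne_zero (zpow_ne_zero _ hQ0) ha), ← mul_assoc, mul_comm Q,
      ← zpow_add_one₀ hQ0, sub_add_cancel]
    exact ih

theorem poch_self_ne_zero {Q : ℂ} (hQ : ‖Q‖ < 1) : poch Q Q ≠ 0 :=
  poch_ne_zero_s15 hQ fun n h ↦ by simpa [h] using norm_mul_pow_lt_one hQ hQ n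

theorem deriv_theta_ne_zero {Q : ℂ} (hQ0 : Q ≠ 0) (hQ : ‖Q‖ < 1) {z : ℂ} (hz : z ≠ 0)
    (h : theta Q z = 0) : deriv (theta Q) z ≠ 0 := by
  obtain ⟨k, rfl⟩ := exists_zpow_eq_of_theta_eq_zero hQ0 hQ hz h
  have := zpow_mul_induction hQ0 (p := fun w ↦ theta Q w = 0 ∧ thetaEuler Q w ≠ 0)
    (fun w hw ↦ by
      rw [theta_mul_left hQ0 hQ hw, thetaEuler_mul_left hQ0 hQ hw]
      simp +contextual [hw]) one_ne_zero
    ⟨theta_one hQ, by simp [thetaEuler_one hQ, poch_self_ne_zero hQ]⟩ k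
  rw [mul_one] at this
  exact right_ne_zero_of_mul this.2

/-- The case `a = b = c = x` of the four-term identity
`1 - L(a) - L(b) - L(c) + L(abc) = (Q)_∞² θ(ab) θ(bc) θ(ca) / (θ(a) θ(b) θ(c) θ(abc))`
for the logarithmic derivative `L(z) = z θ'(z) / θ(z)`. -/
theorem thetaEuler_identity {Q : ℂ} (hQ0 : Q ≠ 0) (hQ : ‖Q‖ < 1) {x : ℂ} (hx : x ≠ 0)
    (h1 : ∀ k : ℤ, x ≠ Q ^ k) (h2 : ∀ k : ℤ, x ^ 2 ≠ Q ^ k) (h3 : ∀ k : ℤ, x ^ 3 ≠ Q ^ k) :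
    1 - 3 * (thetaEuler Q x / theta Q x) + thetaEuler Q (x ^ 3) / theta Q (x ^ 3)
      = poch Q Q ^ 2 * theta Q (x ^ 2) ^ 3 / (theta Q x ^ 3 * theta Q (x ^ 3)) := by
  have hx2 : x ^ 2 ≠ 0 := pow_ne_zero 2 hx
  have hx3 : x ^ 3 ≠ 0 := pow_ne_zero 3 hx
  have t1 : theta Q x ≠ 0 := fun h ↦
    (exists_zpow_eq_of_theta_eq_zero hQ0 hQ hx h).elim fun k hk ↦ h1 k hk
  have t3 : theta Q (x ^ 3) ≠ 0 := fun h ↦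
    (exists_zpow_eq_of_theta_eq_zero hQ0 hQ hx3 h).elim fun k hk ↦ h3 k hk
  set M : ℂ → ℂ := fun z ↦ theta Q z * theta Q (x ^ 2 * z) with hM
  set K : ℂ := poch Q Q ^ 2 * theta Q (x ^ 2) / theta Q x ^ 2 with hK
  set N : ℂ → ℂ := fun z ↦ (1 - 2 * (thetaEuler Q x / theta Q x)) * M z
    - thetaEuler Q z * theta Q (x ^ 2 * z) + thetaEuler Q (x ^ 2 * z) * theta Q z
    - K * theta Q (x * z) ^ 2 with hN
  have dcomp {f : ℂ → ℂ} (hf : DifferentiableOn ℂ f {0}ᶜ) {c : ℂ} (hc : c ≠ 0) :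
      DifferentiableOn ℂ (fun z ↦ f (c * z)) {0}ᶜ :=
    hf.comp (f := fun z ↦ c * z) (by fun_prop) fun z hz ↦ mul_ne_zero hc hz
  have dθ := differentiableOn_theta hQ
  have dE := differentiableOn_thetaEuler hQ
  have dM : DifferentiableOn ℂ M {0}ᶜ := dθ.mul (dcomp dθ hx2)
  have dN : DifferentiableOn ℂ N {0}ᶜ :=
    (((dM.const_mul _).sub (dE.mul (dcomp dθ hx2))).add ((dcomp dE hx2).mul dθ)).sub
      (((dcomp dθ hx).pow 2).const_mul K)
  have shift (c z : ℂ) : c * (Q * z) = Q * (c * z) := by ring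
  have hμ : ∀ z : ℂ, z ≠ 0 → (x ^ 2 * z ^ 2)⁻¹ ≠ 0 := fun z hz ↦
    inv_ne_zero (mul_ne_zero hx2 (pow_ne_zero 2 hz))
  have qM : ∀ z ≠ 0, M (Q * z) = (x ^ 2 * z ^ 2)⁻¹ * M z := by
    intro z hz
    simp only [hM, shift]
    rw [theta_mul_left hQ0 hQ hz, theta_mul_left hQ0 hQ (mul_ne_zero hx2 hz)]
    field_simp
  have qN : ∀ z ≠ 0, N (Q * z) = (x ^ 2 * z ^ 2)⁻¹ * N z := by
    intro z hz
    simp only [hN, qM z hz]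
    simp only [hM, shift]
    rw [theta_mul_left hQ0 hQ hz, theta_mul_left hQ0 hQ (mul_ne_zero hx2 hz),
      theta_mul_left hQ0 hQ (mul_ne_zero hx hz), thetaEuler_mul_left hQ0 hQ hz,
      thetaEuler_mul_left hQ0 hQ (mul_ne_zero hx2 hz)]
    field_simp
    ring
  have ne_of_zero : ∀ z ≠ 0, theta Q z = 0 → theta Q (x ^ 2 * z) ≠ 0 := by
    intro z hz h h'
    obtain ⟨k, hk⟩ := exists_zpow_eq_of_theta_eq_zero hQ0 hQ hz h
    obtain ⟨l, hl⟩ := exists_zpow_eq_of_theta_eq_zero hQ0 hQ (mul_ne_zero hx2 hz) h'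
    refine h2 (l - k) ?_
    rw [zpow_sub₀ hQ0, ← hl, ← hk, mul_div_cancel_right₀ _ hz]
  have hsimple : ∀ z ≠ 0, M z = 0 → deriv M z ≠ 0 := by
    intro z hz h
    have hxz := mul_ne_zero hx2 hz
    have d2 : HasDerivAt (fun w ↦ theta Q (x ^ 2 * w)) (deriv (theta Q) (x ^ 2 * z) * x ^ 2) z :=
      HasDerivAt.comp z (differentiableAt_theta hQ hxz).hasDerivAt
        (by simpa using (hasDerivAt_id z).const_mul (x ^ 2))
    have d := (differentiableAt_theta hQ hz).hasDerivAt.mul d2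
    have hd : deriv M z = _ := d.deriv
    rw [hd]
    rcases mul_eq_zero.1 h with h | h
    · rw [h, zero_mul, add_zero]
      exact mul_ne_zero (deriv_theta_ne_zero hQ0 hQ hz h) (ne_of_zero z hz h)
    · rw [h, mul_zero, zero_add]
      exact mul_ne_zero (fun h' ↦ ne_of_zero z hz h' h)
        (mul_ne_zero (deriv_theta_ne_zero hQ0 hQ hxz h) hx2)
  have propagate {a : ℂ} (ha : a ≠ 0) (h : N a = 0) (k : ℤ) : N (Q ^ k * a) = 0 :=
    zpow_mul_induction hQ0 (p := fun w ↦ N w = 0)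
      (fun z hz ↦ by rw [qN z hz, mul_eq_zero, or_iff_right (hμ z hz)]) ha h k
  have hN1 : N 1 = 0 := by
    simp only [hN, hM, hK, mul_one, theta_one hQ, thetaEuler_one hQ]
    field_simp
    ring
  have hN2 : N (x ^ 2)⁻¹ = 0 := by
    have e : x * (x ^ 2)⁻¹ = x⁻¹ := by field_simp
    simp only [hN, hM, hK, mul_inv_cancel₀ hx2, theta_one hQ, thetaEuler_one hQ, e,
      theta_inv hQ hx, theta_inv hQ hx2]
    field_simp
    ring
  have hzero : ∀ z ≠ 0, M z = 0 → N z = 0 := by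
    intro z hz h
    rcases mul_eq_zero.1 h with h | h
    · obtain ⟨k, rfl⟩ := exists_zpow_eq_of_theta_eq_zero hQ0 hQ hz h
      simpa using propagate one_ne_zero hN1 k
    · obtain ⟨k, hk⟩ := exists_zpow_eq_of_theta_eq_zero hQ0 hQ (mul_ne_zero hx2 hz) h
      have := propagate (inv_ne_zero hx2) hN2 k
      rwa [← hk, mul_comm (x ^ 2), mul_inv_cancel_right₀ hx2] at this
  obtain ⟨C, hC⟩ := exists_const_of_quasiperiodic hQ0 hQ dN dM hμ qN qM hsimple hzero
  have hC0 : C = 0 := by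
    have e : x ^ 2 * x⁻¹ = x := by field_simp
    have hNx : N x⁻¹ = 0 := by
      simp only [hN, hM, mul_inv_cancel₀ hx, theta_one hQ, e, theta_inv hQ hx,
        thetaEuler_inv hQ hx]
      field_simp
      ring
    have := hC x⁻¹ (inv_ne_zero hx)
    rw [hNx] at this
    refine (mul_eq_zero.1 this.symm).resolve_right ?_
    simp only [hM, e, theta_inv hQ hx]
    exact mul_ne_zero (neg_ne_zero.2 (div_ne_zero t1 hx)) t1
  have hNx := hC x hx
  rw [hC0, zero_mul] at hNx
  have e3 : x ^ 2 * x = x ^ 3 := by ring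
  have e2 : x * x = x ^ 2 := by ring
  simp only [hN, hM, hK, e3, e2] at hNx
  field_simp at hNx ⊢
  linear_combination hNx

theorem thetaEuler_div_theta {Q : ℂ} (hQ : ‖Q‖ < 1) {x : ℂ} (hx : x ≠ 0)
    (h1 : ‖x‖ < 1) (h2 : ‖Q / x‖ < 1) :
    thetaEuler Q x / theta Q x = ∑' m : ℕ, (Q / x) ^ (m + 1) / (1 - Q ^ (m + 1))
      - ∑' m : ℕ, x ^ (m + 1) / (1 - Q ^ (m + 1)) := by
  have hne {y : ℂ} (hy : ‖y‖ < 1) : poch y Q ≠ 0 := poch_ne_zero_s15 hQ fun n h ↦ by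
    simpa [h] using norm_mul_pow_lt_one hQ hy n
  have hdiv : HasDerivAt (fun z ↦ Q / z) (-(Q / x ^ 2)) x := by
    simpa [div_eq_mul_inv] using (hasDerivAt_inv hx).const_mul Q
  have hd := (differentiable_poch hQ x).hasDerivAt.mul
    (HasDerivAt.comp x (h₂ := fun z ↦ poch z Q) (differentiable_poch hQ (Q / x)).hasDerivAt hdiv)
  have hE : thetaEuler Q x = x * _ := congrArg (x * ·) hd.deriv
  have l1 := mul_logDeriv_poch hQ h1
  have l2 := mul_logDeriv_poch hQ h2
  rw [logDeriv_apply] at l1 l2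
  rw [hE, theta, ← neg_neg (∑' m : ℕ, (Q / x) ^ (m + 1) / _), ← l2, sub_eq_add_neg, ← l1]
  have := hne h1
  have := hne h2
  simp only [Function.comp_apply]
  field_simp
  ring

theorem pow_ne_pow_five_zpow {q : ℂ} (hq0 : q ≠ 0) (hq : ‖q‖ < 1) {j : ℕ} (hj : ¬ 5 ∣ j) (k : ℤ) :
    q ^ j ≠ (q ^ 5) ^ k := by
  intro h
  have h' : ‖q‖ ^ (j : ℤ) = ‖q‖ ^ (5 * k) := by
    simpa [zpow_mul, ← norm_pow, ← norm_zpow] using congrArg norm h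
  have := zpow_right_injective₀ (norm_pos_iff.2 hq0) hq.ne h'
  omega

end

/-- Lemma 2.3, identity (2.21): for `0 < |q| < 1`,
`∑_{n≥1} (qⁿ + q^{2n} − q^{3n} − q^{4n})/(1 − q^{5n})
  = (2/5)(q², q³, q⁵; q⁵)_∞² / (q, q⁴; q⁵)_∞³
    − (q/5)(q, q⁴, q⁵; q⁵)_∞² / (q², q³; q⁵)_∞³ − 2/5`. -/
theorem statement_15 (q : ℂ) (hq0 : q ≠ 0) (hq : ‖q‖ < 1) :
    (∑' n : ℕ, (q ^ (n + 1) + q ^ (2 * (n + 1)) - q ^ (3 * (n + 1))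
        - q ^ (4 * (n + 1))) / (1 - q ^ (5 * (n + 1))))
    = 2 / 5 * (poch (q ^ 2) (q ^ 5) * poch (q ^ 3) (q ^ 5)
          * poch (q ^ 5) (q ^ 5)) ^ 2
        / (poch q (q ^ 5) * poch (q ^ 4) (q ^ 5)) ^ 3
      - q / 5 * (poch q (q ^ 5) * poch (q ^ 4) (q ^ 5)
          * poch (q ^ 5) (q ^ 5)) ^ 2
        / (poch (q ^ 2) (q ^ 5) * poch (q ^ 3) (q ^ 5)) ^ 3
      - 2 / 5 := by
  have hq5 : q ^ 5 ≠ 0 := pow_ne_zero 5 hq0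
  have hlt {j : ℕ} (hj : j ≠ 0) : ‖q ^ j‖ < 1 := by
    rw [norm_pow]; exact pow_lt_one₀ (norm_nonneg q) hq hj
  have hQ : ‖q ^ 5‖ < 1 := hlt (by norm_num)
  have d1 : q ^ 5 / q = q ^ 4 := by field_simp
  have d2 : q ^ 5 / q ^ 2 = q ^ 3 := by field_simp
  have d3 : q ^ 5 / q ^ 3 = q ^ 2 := by field_simp
  set S : ℕ → ℂ := fun j ↦ ∑' m : ℕ, (q ^ j) ^ (m + 1) / (1 - (q ^ 5) ^ (m + 1)) with hS
  have hsum {j : ℕ} (hj : j ≠ 0) :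
      Summable fun m : ℕ ↦ (q ^ j) ^ (m + 1) / (1 - (q ^ 5) ^ (m + 1)) :=
    (hasSum_lambert hQ (hlt hj)).summable
  have hlhs : (∑' n : ℕ, (q ^ (n + 1) + q ^ (2 * (n + 1)) - q ^ (3 * (n + 1))
      - q ^ (4 * (n + 1))) / (1 - q ^ (5 * (n + 1)))) = S 1 + S 2 - S 3 - S 4 := by
    have h12 := (hsum one_ne_zero).add (hsum two_ne_zero)
    have h123 := h12.sub (hsum three_ne_zero)
    rw [hS, ← (hsum one_ne_zero).tsum_add (hsum two_ne_zero), ← h12.tsum_sub (hsum three_ne_zero),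
      ← h123.tsum_sub (hsum four_ne_zero)]
    refine tsum_congr fun n ↦ ?_
    simp only [pow_mul, pow_one]
    ring
  have L1 : thetaEuler (q ^ 5) q / theta (q ^ 5) q = S 4 - S 1 := by
    rw [thetaEuler_div_theta hQ hq0 hq (by rw [d1]; exact hlt four_ne_zero), d1]
    simp only [hS, pow_one]
  have L2 : thetaEuler (q ^ 5) (q ^ 2) / theta (q ^ 5) (q ^ 2) = S 3 - S 2 := by
    rw [thetaEuler_div_theta hQ (pow_ne_zero 2 hq0) (hlt two_ne_zero)
      (by rw [d2]; exact hlt three_ne_zero), d2]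
  have L3 : thetaEuler (q ^ 5) (q ^ 3) / theta (q ^ 5) (q ^ 3) = S 2 - S 3 := by
    rw [thetaEuler_div_theta hQ (pow_ne_zero 3 hq0) (hlt three_ne_zero)
      (by rw [d3]; exact hlt two_ne_zero), d3]
  have hp {j : ℕ} (hj : j ≠ 0) : poch (q ^ j) (q ^ 5) ≠ 0 := poch_ne_zero_s15 hQ fun n h ↦ by
    simpa [h] using norm_mul_pow_lt_one hQ (hlt hj) n
  have p1 : poch q (q ^ 5) ≠ 0 := by simpa using hp one_ne_zero
  have p2 := hp two_ne_zero
  have p3 := hp three_ne_zero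
  have p4 := hp four_ne_zero
  have t1 : theta (q ^ 5) q = poch q (q ^ 5) * poch (q ^ 4) (q ^ 5) := by rw [theta, d1]
  have t2 : theta (q ^ 5) (q ^ 2) = poch (q ^ 2) (q ^ 5) * poch (q ^ 3) (q ^ 5) := by
    rw [theta, d2]
  have t3 : theta (q ^ 5) (q ^ 3) = poch (q ^ 2) (q ^ 5) * poch (q ^ 3) (q ^ 5) := by
    rw [theta, d3, mul_comm]
  have t4 : theta (q ^ 5) (q ^ 4) = poch q (q ^ 5) * poch (q ^ 4) (q ^ 5) := by
    rw [theta, show q ^ 5 / q ^ 4 = q by field_simp, mul_comm]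
  have t1ne : theta (q ^ 5) q ≠ 0 := t1 ▸ mul_ne_zero p1 p4
  have e6 : q ^ 6 = q ^ 5 * q := by ring
  have t6 : theta (q ^ 5) (q ^ 6) = -(theta (q ^ 5) q / q) := by
    rw [e6, theta_mul_left hq5 hQ hq0]
  have L6 : thetaEuler (q ^ 5) (q ^ 6) / theta (q ^ 5) (q ^ 6) = S 4 - S 1 - 1 := by
    rw [t6, e6, thetaEuler_mul_left hq5 hQ hq0, ← L1]
    field_simp
  have I1 := thetaEuler_identity hq5 hQ hq0
    (fun k ↦ by simpa using pow_ne_pow_five_zpow hq0 hq (j := 1) (by norm_num) k)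
    (pow_ne_pow_five_zpow hq0 hq (by norm_num)) (pow_ne_pow_five_zpow hq0 hq (by norm_num))
  have I2 := thetaEuler_identity hq5 hQ (pow_ne_zero 2 hq0)
    (pow_ne_pow_five_zpow hq0 hq (by norm_num))
    (fun k ↦ by rw [← pow_mul]; exact pow_ne_pow_five_zpow hq0 hq (by norm_num) k)
    (fun k ↦ by rw [← pow_mul]; exact pow_ne_pow_five_zpow hq0 hq (by norm_num) k)
  simp only [← pow_mul, Nat.reduceMul] at I2
  rw [L1, L3, t1, t2, t3] at I1
  rw [L2, L6, t6, t4, t1, t2] at I2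
  have A : 2 / 5 * (poch (q ^ 2) (q ^ 5) * poch (q ^ 3) (q ^ 5) * poch (q ^ 5) (q ^ 5)) ^ 2
      / (poch q (q ^ 5) * poch (q ^ 4) (q ^ 5)) ^ 3
      = 2 / 5 * (1 - 3 * (S 4 - S 1) + (S 2 - S 3)) := by
    rw [I1]; field_simp
  have B : q / 5 * (poch q (q ^ 5) * poch (q ^ 4) (q ^ 5) * poch (q ^ 5) (q ^ 5)) ^ 2
      / (poch (q ^ 2) (q ^ 5) * poch (q ^ 3) (q ^ 5)) ^ 3
      = -(1 / 5) * (1 - 3 * (S 3 - S 2) + (S 4 - S 1 - 1)) := by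
    rw [I2]; field_simp
  rw [hlhs, A, B]
  ring

end Beck
end
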